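/- arXiv:1712.01752 — 4 statements merged into one kernel-verified Lean document; each statement's English description precedes it below -/
import Mathlib

section
/- Let K be a field of characteristic zero, let U, V ∈ K[x] with V nonconstant and gcd(U·V′, V) = 1, let m ≥ 2 be an integer, and suppose A, C, D ∈ K[x] satisfy (1/(1−m))·A = C·U·V′ + D·V with deg C < deg V. Then in the field of rational functions K(x) the identity A/(U·V^m) = (C′·V − (m−1)·C·V′)/V^m + ((1−m)·D − U·C′)/(U·V^{m−1}) holds; here the first summand on the right is the derivative of C/V^{m−1} written via the quotient rule. -/
open Polynomial

/-- The identity justifying one step of Hermite reduction: if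
`(1/(1−m))·A = C·U·V′ + D·V` with `deg C < deg V`, then in `K(x)` we have
`A/(U·V^m) = (C′·V − (m−1)·C·V′)/V^m + ((1−m)·D − U·C′)/(U·V^(m−1))`,
the first summand being the derivative of `C/V^(m−1)` written via the quotient rule. -/
theorem hermite_reduction_step {K : Type*} [Field K] [CharZero K]
    (U V A C D : Polynomial K) (hU : U ≠ 0) (hV : 0 < V.degree)
    (m : ℕ) (hm : 2 ≤ m)
    (hcop : IsCoprime (U * derivative V) V)
    (heq : Polynomial.C (1 / (1 - (m : K))) * A = C * U * derivative V + D * V)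
    (hdegC : C.degree < V.degree) :
    algebraMap (Polynomial K) (RatFunc K) A / algebraMap (Polynomial K) (RatFunc K) (U * V ^ m) =
      algebraMap (Polynomial K) (RatFunc K)
          (derivative C * V - Polynomial.C ((m : K) - 1) * C * derivative V) /
        algebraMap (Polynomial K) (RatFunc K) (V ^ m) +
      algebraMap (Polynomial K) (RatFunc K)
          (Polynomial.C (1 - (m : K)) * D - U * derivative C) /
        algebraMap (Polynomial K) (RatFunc K) (U * V ^ (m - 1)) := by
  have hm1 : (1 - (m : K)) ≠ 0 := by
    rw [sub_ne_zero]
    exact_mod_cast (by lia : 1 ≠ m)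
  have hA : A = Polynomial.C (1 - (m : K)) * (C * U * derivative V + D * V) := by
    rw [← heq, ← mul_assoc, ← Polynomial.C_mul, mul_one_div_cancel hm1, Polynomial.C_1, one_mul]
  have hneg : Polynomial.C ((m : K) - 1) = -Polynomial.C (1 - (m : K)) := by
    rw [← Polynomial.C_neg, neg_sub]
  have hU' : algebraMap (Polynomial K) (RatFunc K) U ≠ 0 := RatFunc.algebraMap_ne_zero hU
  have hV' : algebraMap (Polynomial K) (RatFunc K) V ≠ 0 :=
    RatFunc.algebraMap_ne_zero (ne_zero_of_degree_gt hV)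
  obtain ⟨n, rfl⟩ : ∃ n, m = n + 1 := ⟨m - 1, by lia⟩
  rw [hA, hneg, Nat.add_sub_cancel]
  simp only [map_mul, map_add, map_sub, map_neg, map_pow, pow_succ]
  field_simp
  ring
end

section
/- Hermite's theorem: let K be a field of characteristic zero and let f ∈ K(x) be a rational function. Then there exist polynomials P, Q, G, H ∈ K[x] with Q ≠ 0, H nonzero and squarefree, deg G < deg H, such that f = (P′·Q − P·Q′)/Q² + G/H in K(x); that is, f is the sum of the derivative of the rational function P/Q and a rational function whose denominator is squarefree. -/
open Polynomial

/-- The derivative of `P / Q` given by the quotient rule, as a rational function. -/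
noncomputable def quotientDerivative {K : Type*} [Field K] (P Q : K[X]) : RatFunc K :=
  algebraMap K[X] (RatFunc K) (derivative P * Q - P * derivative Q) /
    algebraMap K[X] (RatFunc K) (Q ^ 2)

/-- `f` is the derivative of a rational function plus a proper fraction with squarefree
denominator. -/
def HasHermiteDecomposition {K : Type*} [Field K] (f : RatFunc K) : Prop :=
  ∃ P Q G H : K[X], Q ≠ 0 ∧ H ≠ 0 ∧ Squarefree H ∧ G.degree < H.degree ∧
    f = quotientDerivative P Q +
      algebraMap K[X] (RatFunc K) G / algebraMap K[X] (RatFunc K) H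

theorem quotientDerivative_add {K : Type*} [Field K] {P₁ Q₁ P₂ Q₂ : K[X]}
    (h₁ : Q₁ ≠ 0) (h₂ : Q₂ ≠ 0) :
    quotientDerivative P₁ Q₁ + quotientDerivative P₂ Q₂ =
      quotientDerivative (P₁ * Q₂ + P₂ * Q₁) (Q₁ * Q₂) := by
  have h₁' := RatFunc.algebraMap_ne_zero h₁
  have h₂' := RatFunc.algebraMap_ne_zero h₂
  simp only [quotientDerivative, derivative_mul, map_mul, map_add, map_sub,
    map_pow]
  field_simp
  ring

theorem HasHermiteDecomposition.quotientDerivative_add {K : Type*} [Field K] {f : RatFunc K}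
    (hf : HasHermiteDecomposition f) (P : K[X]) {Q : K[X]} (hQ : Q ≠ 0) :
    HasHermiteDecomposition (quotientDerivative P Q + f) := by
  obtain ⟨P₁, Q₁, G, H, hQ₁, hH, hsq, hdeg, rfl⟩ := hf
  exact ⟨_, _, G, H, mul_ne_zero hQ hQ₁, hH, hsq, hdeg, by
    rw [← _root_.quotientDerivative_add hQ hQ₁, add_assoc]⟩

theorem Polynomial.derivative_surjective {K : Type*} [Field K] [CharZero K] :
    Function.Surjective (derivative : K[X] → K[X]) := by
  intro q
  induction q using Polynomial.induction_on' with
  | add p q hp hq =>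
    obtain ⟨a, rfl⟩ := hp
    obtain ⟨b, rfl⟩ := hq
    exact ⟨a + b, derivative_add⟩
  | monomial n a =>
    refine ⟨monomial (n + 1) (a / (n + 1)), ?_⟩
    have : (n + 1 : K) ≠ 0 := by exact_mod_cast n.succ_ne_zero
    simp [this]

theorem hasHermiteDecomposition_div_of_squarefree {K : Type*} [Field K] [CharZero K]
    (A : K[X]) {D : K[X]} (hD : D ≠ 0) (hsq : Squarefree D) :
    HasHermiteDecomposition
      (algebraMap K[X] (RatFunc K) A / algebraMap K[X] (RatFunc K) D) := by
  obtain ⟨P, hP⟩ := Polynomial.derivative_surjective (A / D)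
  refine ⟨P, 1, A % D, D, one_ne_zero, hD, hsq, EuclideanDomain.mod_lt A hD, ?_⟩
  have hD' := RatFunc.algebraMap_ne_zero hD
  have h := congrArg (algebraMap K[X] (RatFunc K)) (EuclideanDomain.div_add_mod A D)
  rw [map_add, map_mul] at h
  simp only [quotientDerivative, hP, derivative_one, mul_zero, sub_zero, mul_one, one_pow,
    map_one, div_one]
  field_simp
  exact h.symm

/-- One step of Hermite reduction: the exponent of an irreducible factor `p` of the denominator
drops by one, at the cost of the derivative of a fraction. -/
theorem exists_hermite_reduction {K : Type*} [Field K] [CharZero K] (A : K[X]) {p V : K[X]}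
    (hp : Irreducible p) (hV : ¬ p ∣ V) (m : ℕ) :
    ∃ B C : K[X],
      algebraMap K[X] (RatFunc K) A / algebraMap K[X] (RatFunc K) (p ^ (m + 2) * V) =
        quotientDerivative C (p ^ (m + 1)) +
          algebraMap K[X] (RatFunc K) B / algebraMap K[X] (RatFunc K) (p ^ (m + 1) * V) := by
  obtain ⟨u, v, huv⟩ : IsCoprime p (derivative p * V) :=
    IsCoprime.mul_right hp.separable (hp.coprime_iff_not_dvd.2 hV)
  let c : K[X] := Polynomial.C ((m + 1 : K)⁻¹)
  have hc : ((m : K[X]) + 1) * c = 1 := by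
    have : (m + 1 : K) ≠ 0 := by exact_mod_cast m.succ_ne_zero
    have e : ((m : K[X]) + 1) = Polynomial.C (m + 1 : K) := by simp
    rw [e, ← Polynomial.C_mul, mul_inv_cancel₀ this, Polynomial.C_1]
  obtain ⟨C, hC⟩ : ∃ C, C = -(c * A * v) := ⟨_, rfl⟩
  obtain ⟨B, hB⟩ : ∃ B, B = A * u - derivative C * V := ⟨_, rfl⟩
  refine ⟨B, C, ?_⟩
  have key : A = B * p + (derivative C * p - (m + 1) * C * derivative p) * V := by
    rw [hB]
    linear_combination (-A) * huv + (-(derivative p * V * A * v)) * hc +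
      (m + 1) * derivative p * V * hC
  have hp' := RatFunc.algebraMap_ne_zero hp.ne_zero
  have hV' := RatFunc.algebraMap_ne_zero (fun h : V = 0 => hV (h ▸ dvd_zero p))
  rw [key]
  simp only [quotientDerivative, derivative_pow, map_mul, map_add, map_sub, map_pow,
    Nat.add_sub_cancel, map_natCast, Nat.cast_add, Nat.cast_one, map_one]
  field_simp
  ring

theorem hasHermiteDecomposition_div {K : Type*} [Field K] [CharZero K] (A : K[X]) {D : K[X]}
    (hD : D ≠ 0) :
    HasHermiteDecomposition
      (algebraMap K[X] (RatFunc K) A / algebraMap K[X] (RatFunc K) D) := by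
  induction hn : D.natDegree using Nat.strong_induction_on generalizing A D with
  | _ n ih =>
    by_cases hsq : Squarefree D
    · exact hasHermiteDecomposition_div_of_squarefree A hD hsq
    obtain ⟨p, hp, hpD⟩ : ∃ p, Irreducible p ∧ p * p ∣ D := by
      simpa [squarefree_iff_irreducible_sq_not_dvd_of_ne_zero hD] using hsq
    obtain ⟨W, hW⟩ := hpD
    have hW0 : W ≠ 0 := by rintro rfl; simp [hW] at hD
    obtain ⟨V, hWV, hV⟩ :=
      (FiniteMultiplicity.of_prime_left hp.prime hW0).exists_eq_pow_mul_and_not_dvd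
    set m := multiplicity p W
    have hDV : D = p ^ (m + 2) * V := by rw [hW, hWV]; ring
    have hV0 : V ≠ 0 := by rintro rfl; simp at hV
    obtain ⟨B, C, hBC⟩ := exists_hermite_reduction A hp hV m
    have hne : p ^ (m + 1) * V ≠ 0 := mul_ne_zero (pow_ne_zero _ hp.ne_zero) hV0
    have hlt : (p ^ (m + 1) * V).natDegree < n := by
      have hsplit : D = p * (p ^ (m + 1) * V) := by rw [hDV]; ring
      rw [← hn, hsplit, natDegree_mul hp.ne_zero hne]
      have := hp.natDegree_pos
      omega
    rw [hDV, hBC]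
    exact (ih _ hlt B hne rfl).quotientDerivative_add C (pow_ne_zero _ hp.ne_zero)



/-- Hermite's theorem: every rational function `f ∈ K(x)` over a field of
characteristic zero can be written as the derivative of a rational function `P/Q`
(expressed via the quotient rule) plus a rational function `G/H` with `H`
squarefree and `deg G < deg H`. -/
theorem hermite_theorem {K : Type*} [Field K] [CharZero K] (f : RatFunc K) :
    ∃ P Q G H : Polynomial K, Q ≠ 0 ∧ H ≠ 0 ∧ Squarefree H ∧ G.degree < H.degree ∧
      f = algebraMap (Polynomial K) (RatFunc K) (derivative P * Q - P * derivative Q) /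
            algebraMap (Polynomial K) (RatFunc K) (Q ^ 2) +
          algebraMap (Polynomial K) (RatFunc K) G / algebraMap (Polynomial K) (RatFunc K) H := by
  rw [← f.num_div_denom]
  exact hasHermiteDecomposition_div f.num f.denom_ne_zero
end

section
/- Partial fraction decomposition with explicit residues: let H ∈ ℂ[x] be a nonconstant squarefree polynomial and let G ∈ ℂ[x] with deg G < deg H. Then in ℂ(x) one has G/H = ∑_{γ ∈ roots(H)} (G(γ)/H′(γ)) · 1/(X − γ), where the sum ranges over the (necessarily distinct) complex roots of H. -/
open Polynomial

/-- Partial fraction decomposition with explicit residues: for a nonconstant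
squarefree `H ∈ ℂ[x]` and `G ∈ ℂ[x]` with `deg G < deg H`, in `ℂ(x)` one has
`G/H = ∑_{γ ∈ roots H} (G(γ)/H′(γ)) · 1/(X − γ)`. -/
theorem pfd_with_residues (H G : Polynomial ℂ) (hH : 0 < H.degree)
    (hsf : Squarefree H) (hdeg : G.degree < H.degree) :
    algebraMap (Polynomial ℂ) (RatFunc ℂ) G / algebraMap (Polynomial ℂ) (RatFunc ℂ) H =
      ∑ γ ∈ H.roots.toFinset,
        algebraMap ℂ (RatFunc ℂ) (G.eval γ / (derivative H).eval γ) *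
          (algebraMap (Polynomial ℂ) (RatFunc ℂ) (X - Polynomial.C γ))⁻¹ := by
  classical
  set s := H.roots.toFinset with hs
  have hH0 : H ≠ 0 := hsf.ne_zero
  have hlc : H.leadingCoeff ≠ 0 := leadingCoeff_ne_zero.mpr hH0
  have hnodup : H.roots.Nodup := nodup_roots (PerfectField.separable_iff_squarefree.mpr hsf)
  have hfac : H = C H.leadingCoeff * Lagrange.nodal s id := by
    conv_lhs => rw [(IsAlgClosed.splits H).eq_prod_roots]
    rw [Lagrange.nodal, Finset.prod, hs, Multiset.toFinset_val, hnodup.dedup]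
    rfl
  have hcard : H.degree = s.card := by
    conv_lhs => rw [hfac]
    rw [degree_C_mul hlc, Lagrange.degree_nodal]
  have hG : G = Lagrange.interpolate s id (fun γ => G.eval γ) :=
    Lagrange.eq_interpolate (Set.injOn_id _) (hcard ▸ hdeg)
  have hinj := RatFunc.algebraMap_injective ℂ
  have hHne : algebraMap ℂ[X] (RatFunc ℂ) H ≠ 0 :=
    (map_ne_zero_iff _ hinj).mpr hH0
  have hC (a : ℂ) : algebraMap ℂ (RatFunc ℂ) a = algebraMap ℂ[X] (RatFunc ℂ) (C a) :=
    IsScalarTower.algebraMap_apply ℂ ℂ[X] (RatFunc ℂ) a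
  rw [div_eq_iff hHne, Finset.sum_mul]
  conv_lhs => rw [hG, Lagrange.interpolate_apply, map_sum]
  refine Finset.sum_congr rfl fun γ hγ => ?_
  have hX : algebraMap ℂ[X] (RatFunc ℂ) (X - C γ) ≠ 0 :=
    (map_ne_zero_iff _ hinj).mpr (X_sub_C_ne_zero γ)
  have hder : (derivative H).eval γ =
      H.leadingCoeff * (derivative (Lagrange.nodal s id)).eval (id γ) := by
    conv_lhs => rw [hfac]
    simp
  have hnod : Lagrange.nodal s id = (X - C γ) * Lagrange.nodal (s.erase γ) id :=
    Lagrange.nodal_eq_mul_nodal_erase hγ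
  have hcoeff : G.eval γ / (derivative H).eval γ * H.leadingCoeff =
      G.eval γ * Lagrange.nodalWeight s id γ := by
    rw [hder, Lagrange.nodalWeight_eq_eval_derivative_nodal hγ]
    field_simp
  have hbasis : Lagrange.basis s id γ =
      C (Lagrange.nodalWeight s id γ) * Lagrange.nodal (s.erase γ) id := by
    rw [Lagrange.basis_eq_prod_sub_inv_mul_nodal_div hγ, Lagrange.nodal_erase_eq_nodal_div hγ]
  rw [mul_assoc, ← div_eq_inv_mul, mul_div_assoc', eq_div_iff hX, hC, ← map_mul, ← map_mul]
  congr 1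
  calc C (G.eval γ) * Lagrange.basis s id γ * (X - C γ)
      = C (G.eval γ * Lagrange.nodalWeight s id γ) * Lagrange.nodal s id := by
        rw [hbasis, hnod, C_mul]
        ring
    _ = C (G.eval γ / (derivative H).eval γ) *
          (C H.leadingCoeff * Lagrange.nodal s id) := by
        rw [← hcoeff, C_mul, mul_assoc]
    _ = C (G.eval γ / (derivative H).eval γ) * H := by rw [← hfac]
end

section
/- Arctangent combination rule (derivative form): let X, Y : ℝ → ℝ be differentiable at x₀, let α, β ∈ ℝ with β ≠ 0, and suppose Y(x₀) ≠ 0 and Y(x₀)·(α−x₀) + β·X(x₀) ≠ 0. Then the derivative at x₀ of x ↦ arctan(X(x)/Y(x)) + arctan((α−x)/β) equals the derivative at x₀ of x ↦ arctan( (X(x)·(α−x) − β·Y(x)) / (Y(x)·(α−x) + β·X(x)) ). -/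
/-- The derivative of the arctangent of a quotient, in denominator-free form. -/
theorem HasDerivAt.arctan_div {P Q : ℝ → ℝ} {P' Q' x : ℝ}
    (hP : HasDerivAt P P' x) (hQ : HasDerivAt Q Q' x) (hx : Q x ≠ 0) :
    HasDerivAt (fun t => Real.arctan (P t / Q t))
      ((P' * Q x - P x * Q') / (P x ^ 2 + Q x ^ 2)) x := by
  convert (hP.fun_div hQ hx).arctan using 1
  have hPQ : P x ^ 2 + Q x ^ 2 ≠ 0 := by positivity
  have hQP : Q x ^ 2 + P x ^ 2 ≠ 0 := by positivity
  field_simp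
  ring

/-- Arctangent combination rule (derivative form): for `X, Y : ℝ → ℝ`
differentiable at `x₀`, `β ≠ 0`, `Y(x₀) ≠ 0` and `Y(x₀)·(α−x₀) + β·X(x₀) ≠ 0`,
the derivative at `x₀` of `x ↦ arctan(X/Y) + arctan((α−x)/β)` equals the
derivative at `x₀` of `x ↦ arctan((X·(α−x) − β·Y)/(Y·(α−x) + β·X))`. -/
theorem arctan_combination_rule (X Y : ℝ → ℝ) (x₀ α β : ℝ)
    (hX : DifferentiableAt ℝ X x₀) (hY : DifferentiableAt ℝ Y x₀)
    (hβ : β ≠ 0) (hY0 : Y x₀ ≠ 0) (hden : Y x₀ * (α - x₀) + β * X x₀ ≠ 0) :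
    deriv (fun x => Real.arctan (X x / Y x) + Real.arctan ((α - x) / β)) x₀ =
      deriv (fun x =>
        Real.arctan ((X x * (α - x) - β * Y x) / (Y x * (α - x) + β * X x))) x₀ := by
  have hα : HasDerivAt (fun x => α - x) (-1) x₀ := (hasDerivAt_id x₀).const_sub α
  have hX' := hX.hasDerivAt
  have hY' := hY.hasDerivAt
  have hleft := (hX'.arctan_div hY' hY0).add (hα.arctan_div (hasDerivAt_const x₀ β) hβ)
  have hright := ((hX'.fun_mul hα).fun_sub (hY'.const_mul β)).arctan_div
    ((hY'.fun_mul hα).fun_add (hX'.const_mul β)) hden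
  refine hleft.deriv.trans (Eq.trans ?_ hright.deriv.symm)
  have hXY : X x₀ ^ 2 + Y x₀ ^ 2 ≠ 0 := by positivity
  have hαβ : (α - x₀) ^ 2 + β ^ 2 ≠ 0 := by positivity
  have hnorm : (X x₀ * (α - x₀) - β * Y x₀) ^ 2 + (Y x₀ * (α - x₀) + β * X x₀) ^ 2 =
      (X x₀ ^ 2 + Y x₀ ^ 2) * ((α - x₀) ^ 2 + β ^ 2) := by ring
  rw [hnorm, div_add_div _ _ hXY hαβ]
  congr 1
  ring
end
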